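/- Let J₉(x,y) = −1 + 2·Re(j₉(x+iy, x−iy)) with j₉(u,v) = (9−27b)u³ − 9b·u⁶ − b·u⁹ + (27/2)uv − (9−54b)u⁴v + 9b·u⁷v − 27u²v² − 27b·u⁵v² + 15u³v³, b = exp(−iπ/3), and let f : ℝ⁴ → ℝ be f(x₀,x₁,x₂,x₃) = J₉(x₀,x₁) − J₉(x₂,x₃). Then the set {p ∈ ℝ⁴ : f(p) = 0 and ∇f(p) = 0} consists of exactly 1738 points, and at each of these points the Hessian matrix of f is invertible; i.e. the affine three-fold f = 0 has exactly 1738 real nodes (A₁-singularities). -/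

import Mathlib

noncomputable section

/-- `bC = exp(-iπ/3)`. -/
def bC : ℂ := Complex.exp (-((Real.pi : ℂ) / 3) * Complex.I)

/-- The polynomial `j9(u,v)`. -/
def j9 (u v : ℂ) : ℂ := (9 - 27*bC)*u^3 - 9*bC*u^6 - bC*u^9 + (27/2)*u*v - (9 - 54*bC)*u^4*v + 9*bC*u^7*v - 27*u^2*v^2 - 27*bC*u^5*v^2 + 15*u^3*v^3

/-- The real folding-type polynomial `J9(x,y) = -1 + 2 Re(j9(x+iy, x-iy))`. -/
def J9R (x y : ℝ) : ℝ :=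
  -1 + 2 * (j9 ((x : ℂ) + (y : ℂ) * Complex.I) ((x : ℂ) - (y : ℂ) * Complex.I)).re

/-- Partial derivative of `f` in the `i`-th coordinate direction. -/
def pd {n : ℕ} (i : Fin n) (f : (Fin n → ℝ) → ℝ) (x : Fin n → ℝ) : ℝ :=
  deriv (fun t => f (Function.update x i t)) (x i)

/-- Hessian matrix of `f` at `x`. -/
def hessian {n : ℕ} (f : (Fin n → ℝ) → ℝ) (x : Fin n → ℝ) : Matrix (Fin n) (Fin n) ℝ :=
  Matrix.of fun i j => pd i (pd j f) x

def nP (u v e : ℂ) : ℂ :=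
  u^9 - 9*u^7*v + 9*u^6*e + 27*u^5*v^2 - 45*u^4*v*e - 30*u^3*v^3 + 18*u^3*e^2 + 54*u^2*v^2*e + 9*u*v^4 - 27*u*v*e^2 - 9*v^3*e + 3*e^3

def nPu (u v e : ℂ) : ℂ :=
  9*u^8 - 63*u^6*v + 54*u^5*e + 135*u^4*v^2 - 180*u^3*v*e - 90*u^2*v^3 + 54*u^2*e^2 + 108*u*v^2*e + 9*v^4 - 27*v*e^2

def nPv (u v e : ℂ) : ℂ :=
  (-9)*u^7 + 54*u^5*v - 45*u^4*e - 90*u^3*v^2 + 108*u^2*v*e + 36*u*v^3 - 27*u*e^2 - 27*v^2*e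

def nPuu (u v e : ℂ) : ℂ :=
  72*u^7 - 378*u^5*v + 270*u^4*e + 540*u^3*v^2 - 540*u^2*v*e - 180*u*v^3 + 108*u*e^2 + 108*v^2*e

def nPuv (u v e : ℂ) : ℂ :=
  (-63)*u^6 + 270*u^4*v - 180*u^3*e - 270*u^2*v^2 + 216*u*v*e + 36*v^3 - 27*e^2

def nPvv (u v e : ℂ) : ℂ :=
  54*u^5 - 180*u^3*v + 108*u^2*e + 108*u*v^2 - 54*v*e

/-! ### Power sum identities -/

lemma nP_sum (a b c : ℂ) :
    nP (a+b+c) (a*b+b*c+c*a) (a*b*c) = a^9+b^9+c^9 := by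
  unfold nP; ring

lemma nP_d1 (a b c : ℂ) :
    nPu (a+b+c) (a*b+b*c+c*a) (a*b*c) * (a-c) + nPv (a+b+c) (a*b+b*c+c*a) (a*b*c) * (b*(a-c))
      = 9*(a^9-c^9) := by
  unfold nPu nPv; ring

lemma nP_d2 (a b c : ℂ) :
    nPu (a+b+c) (a*b+b*c+c*a) (a*b*c) * (b-c) + nPv (a+b+c) (a*b+b*c+c*a) (a*b*c) * (a*(b-c))
      = 9*(b^9-c^9) := by
  unfold nPu nPv; ring

lemma nP_d11 (a b c : ℂ) :
    nPuu (a+b+c) (a*b+b*c+c*a) (a*b*c) * (a-c)^2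
      + 2 * nPuv (a+b+c) (a*b+b*c+c*a) (a*b*c) * (b*(a-c)^2)
      + nPvv (a+b+c) (a*b+b*c+c*a) (a*b*c) * (b*(a-c))^2
      + nPu (a+b+c) (a*b+b*c+c*a) (a*b*c) * (a+c)
      + nPv (a+b+c) (a*b+b*c+c*a) (a*b*c) * (b*(a+c))
      = 81*(a^9+c^9) := by
  unfold nPu nPv nPuu nPuv nPvv; ring

lemma nP_d22 (a b c : ℂ) :
    nPuu (a+b+c) (a*b+b*c+c*a) (a*b*c) * (b-c)^2
      + 2 * nPuv (a+b+c) (a*b+b*c+c*a) (a*b*c) * (a*(b-c)^2)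
      + nPvv (a+b+c) (a*b+b*c+c*a) (a*b*c) * (a*(b-c))^2
      + nPu (a+b+c) (a*b+b*c+c*a) (a*b*c) * (b+c)
      + nPv (a+b+c) (a*b+b*c+c*a) (a*b*c) * (a*(b+c))
      = 81*(b^9+c^9) := by
  unfold nPu nPv nPuu nPuv nPvv; ring

lemma nP_d12 (a b c : ℂ) :
    nPuu (a+b+c) (a*b+b*c+c*a) (a*b*c) * ((a-c)*(b-c))
      + nPuv (a+b+c) (a*b+b*c+c*a) (a*b*c) * ((a-c)*(a*(b-c)) + (b-c)*(b*(a-c)))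
      + nPvv (a+b+c) (a*b+b*c+c*a) (a*b*c) * ((b*(a-c))*(a*(b-c)))
      + nPu (a+b+c) (a*b+b*c+c*a) (a*b*c) * c
      + nPv (a+b+c) (a*b+b*c+c*a) (a*b*c) * (a*b)
      = 81*c^9 := by
  unfold nPu nPv nPuu nPuv nPvv; ring

/-! ### The complexified polynomial and its partial derivatives -/

def gG (u v : ℂ) : ℂ := 2 - bC * nP u v 1 - (1 - bC) * nP v u 1
def gGu (u v : ℂ) : ℂ := - bC * nPu u v 1 - (1 - bC) * nPv v u 1
def gGv (u v : ℂ) : ℂ := - bC * nPv u v 1 - (1 - bC) * nPu v u 1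
def gGuu (u v : ℂ) : ℂ := - bC * nPuu u v 1 - (1 - bC) * nPvv v u 1
def gGuv (u v : ℂ) : ℂ := - bC * nPuv u v 1 - (1 - bC) * nPuv v u 1
def gGvv (u v : ℂ) : ℂ := - bC * nPvv u v 1 - (1 - bC) * nPuu v u 1

/-! ### Torus coordinates -/

lemma torus_swap {a b c : ℂ} (h : a*b*c = 1) :
    b*c + c*a + a*b = a*b+b*c+c*a ∧ (b*c)*(c*a) + (c*a)*(a*b) + (a*b)*(b*c) = a+b+c ∧
      (b*c)*(c*a)*(a*b) = 1 := by
  refine ⟨by ring, ?_, ?_⟩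
  · linear_combination (a+b+c) * h
  · linear_combination (a*b*c+1) * h

lemma gG_torus {a b c : ℂ} (h : a*b*c = 1) :
    gG (a+b+c) (a*b+b*c+c*a) = 2 - bC * (a^9+b^9+c^9)
      - (1-bC) * ((b*c)^9+(c*a)^9+(a*b)^9) := by
  have h1 := nP_sum a b c
  have h2 := nP_sum (b*c) (c*a) (a*b)
  obtain ⟨e1, e2, e3⟩ := torus_swap h
  rw [e1, e2, e3] at h2
  rw [h] at h1
  unfold gG
  rw [h1, h2]

lemma gG_d1 {a b c : ℂ} (h : a*b*c = 1) :
    (gGu (a+b+c) (a*b+b*c+c*a) + gGv (a+b+c) (a*b+b*c+c*a) * b) * (a-c)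
      = -9 * (bC * a^9 - (1-bC) * (b*c)^9) + 9 * (bC * c^9 - (1-bC)*(a*b)^9) := by
  have h1 := nP_d1 a b c
  have h2 := nP_d1 (b*c) (c*a) (a*b)
  obtain ⟨e1, e2, e3⟩ := torus_swap h
  rw [e1, e2, e3] at h2
  rw [h] at h1
  unfold gGu gGv
  generalize nPu (a+b+c) (a*b+b*c+c*a) 1 = A at *
  generalize nPv (a+b+c) (a*b+b*c+c*a) 1 = B at *
  generalize nPu (a*b+b*c+c*a) (a+b+c) 1 = A' at *
  generalize nPv (a*b+b*c+c*a) (a+b+c) 1 = B' at *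
  linear_combination (-bC) * h1 + (1-bC) * h2 + (1-bC) * B' * (a-c) * h

lemma gG_d2 {a b c : ℂ} (h : a*b*c = 1) :
    (gGu (a+b+c) (a*b+b*c+c*a) + gGv (a+b+c) (a*b+b*c+c*a) * a) * (b-c)
      = -9 * (bC * b^9 - (1-bC) * (c*a)^9) + 9 * (bC * c^9 - (1-bC)*(a*b)^9) := by
  have h1 := nP_d2 a b c
  have h2 := nP_d2 (b*c) (c*a) (a*b)
  obtain ⟨e1, e2, e3⟩ := torus_swap h
  rw [e1, e2, e3] at h2
  rw [h] at h1
  unfold gGu gGv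
  generalize nPu (a+b+c) (a*b+b*c+c*a) 1 = A at *
  generalize nPv (a+b+c) (a*b+b*c+c*a) 1 = B at *
  generalize nPu (a*b+b*c+c*a) (a+b+c) 1 = A' at *
  generalize nPv (a*b+b*c+c*a) (a+b+c) 1 = B' at *
  linear_combination (-bC) * h1 + (1-bC) * h2 + (1-bC) * B' * (b-c) * h

lemma gG_d11 {a b c : ℂ} (h : a*b*c = 1) (hgu : gGu (a+b+c) (a*b+b*c+c*a) = 0)
    (hgv : gGv (a+b+c) (a*b+b*c+c*a) = 0) :
    gGuu (a+b+c) (a*b+b*c+c*a) * (a-c)^2 + 2 * gGuv (a+b+c) (a*b+b*c+c*a) * (b*(a-c)^2)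
      + gGvv (a+b+c) (a*b+b*c+c*a) * (b*(a-c))^2
      = -81 * (bC * a^9 + (1-bC) * (b*c)^9 + bC * c^9 + (1-bC)*(a*b)^9) := by
  have h1 := nP_d11 a b c
  have h2 := nP_d11 (b*c) (c*a) (a*b)
  obtain ⟨e1, e2, e3⟩ := torus_swap h
  rw [e1, e2, e3] at h2
  rw [h] at h1
  have i1 : b*c - a*b = -(b*(a-c)) := by ring
  have i2 : c*a*(b*c-a*b) = -(a-c) := by linear_combination (c-a)*h
  have i3 : c*a*(b*c-a*b)^2 = b*(a-c)^2 := by linear_combination (c-a)*(b*c-a*b)*h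
  have i4 : c*a*(b*c+a*b) = a+c := by linear_combination (a+c)*h
  rw [i2, i3, i4, i1] at h2
  unfold gGu at hgu
  unfold gGv at hgv
  unfold gGuu gGuv gGvv
  linear_combination (-bC) * h1 - (1-bC) * h2 - (a+c) * hgu - b*(a+c) * hgv

lemma gG_d22 {a b c : ℂ} (h : a*b*c = 1) (hgu : gGu (a+b+c) (a*b+b*c+c*a) = 0)
    (hgv : gGv (a+b+c) (a*b+b*c+c*a) = 0) :
    gGuu (a+b+c) (a*b+b*c+c*a) * (b-c)^2 + 2 * gGuv (a+b+c) (a*b+b*c+c*a) * (a*(b-c)^2)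
      + gGvv (a+b+c) (a*b+b*c+c*a) * (a*(b-c))^2
      = -81 * (bC * b^9 + (1-bC) * (c*a)^9 + bC * c^9 + (1-bC)*(a*b)^9) := by
  have h1 := nP_d22 a b c
  have h2 := nP_d22 (b*c) (c*a) (a*b)
  obtain ⟨e1, e2, e3⟩ := torus_swap h
  rw [e1, e2, e3] at h2
  rw [h] at h1
  have i1 : c*a - a*b = -(a*(b-c)) := by ring
  have i2 : b*c*(c*a-a*b) = -(b-c) := by linear_combination (c-b)*h
  have i3 : b*c*(c*a-a*b)^2 = a*(b-c)^2 := by linear_combination (c-b)*(c*a-a*b)*h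
  have i4 : b*c*(c*a+a*b) = b+c := by linear_combination (b+c)*h
  rw [i2, i3, i4, i1] at h2
  unfold gGu at hgu
  unfold gGv at hgv
  unfold gGuu gGuv gGvv
  linear_combination (-bC) * h1 - (1-bC) * h2 - (b+c) * hgu - a*(b+c) * hgv

lemma gG_d12 {a b c : ℂ} (h : a*b*c = 1) (hgu : gGu (a+b+c) (a*b+b*c+c*a) = 0)
    (hgv : gGv (a+b+c) (a*b+b*c+c*a) = 0) :
    gGuu (a+b+c) (a*b+b*c+c*a) * ((a-c)*(b-c))
      + gGuv (a+b+c) (a*b+b*c+c*a) * ((a-c)*(a*(b-c)) + (b-c)*(b*(a-c)))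
      + gGvv (a+b+c) (a*b+b*c+c*a) * ((b*(a-c))*(a*(b-c)))
      = -81 * (bC * c^9 + (1-bC)*(a*b)^9) := by
  have h1 := nP_d12 a b c
  have h2 := nP_d12 (b*c) (c*a) (a*b)
  obtain ⟨e1, e2, e3⟩ := torus_swap h
  rw [e1, e2, e3] at h2
  rw [h] at h1
  have i1 : c*a - a*b = -(a*(b-c)) := by ring
  have i2 : b*c*(c*a-a*b) = -(b-c) := by linear_combination (c-b)*h
  have j1 : b*c - a*b = -(b*(a-c)) := by ring
  have j2 : c*a*(b*c-a*b) = -(a-c) := by linear_combination (c-a)*h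
  have i4 : b*c*(c*a) = c := by linear_combination c*h
  rw [i2, j2, i1, j1, i4] at h2
  unfold gGu at hgu
  unfold gGv at hgv
  unfold gGuu gGuv gGvv
  linear_combination (-bC) * h1 - (1-bC) * h2 - c * hgu - a*b * hgv

/-! ### Roots of unity -/

def ep : ℂ := Complex.exp (2 * Real.pi * Complex.I / (54 : ℕ))

lemma ep_prim : IsPrimitiveRoot ep 54 := Complex.isPrimitiveRoot_exp 54 (by norm_num)

lemma bC_eq : bC = ep^45 := by
  unfold bC ep
  rw [← Complex.exp_nat_mul, Complex.exp_eq_exp_iff_exists_int]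
  refine ⟨-1, ?_⟩
  push_cast
  ring

lemma ep27 : ep^27 = -1 := by
  have h : (ep^27 - 1) * (ep^27+1) = 0 := by
    have := ep_prim.pow_eq_one
    linear_combination this
  rcases mul_eq_zero.1 h with h | h
  · exact absurd (sub_eq_zero.1 h) (ep_prim.pow_ne_one_of_pos_of_lt (by norm_num) (by norm_num))
  · linear_combination h

lemma ep9_ne : ep^9 ≠ -1 := by
  rw [← ep27]
  intro h
  have := ep_prim.pow_inj (by norm_num) (by norm_num) h
  omega

lemma ep9_sq : (ep^9)^2 = ep^9 - 1 := by
  have h : (ep^9 + 1) * ((ep^9)^2 - ep^9 + 1) = 0 := by linear_combination ep27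
  rcases mul_eq_zero.1 h with h | h
  · exact absurd (by linear_combination h) ep9_ne
  · linear_combination h

lemma bC_eq' : bC = 1 - ep^9 := by
  rw [bC_eq]
  linear_combination ep^18 * ep27 - ep9_sq

lemma bC_sq : bC^2 = bC - 1 := by
  rw [bC_eq']; linear_combination ep9_sq

lemma conj_ep : (starRingEnd ℂ) ep = ep^53 := by
  have h1 : (starRingEnd ℂ) ep * ep = 1 := by
    have : ‖ep‖ = 1 := by
      unfold ep
      rw [Complex.norm_exp]
      simp
    rw [mul_comm, Complex.mul_conj, Complex.normSq_eq_norm_sq, this]; simp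
  have h2 := ep_prim.pow_eq_one
  calc (starRingEnd ℂ) ep = (starRingEnd ℂ) ep * ep^54 := by rw [h2, mul_one]
    _ = ((starRingEnd ℂ) ep * ep) * ep^53 := by ring
    _ = _ := by rw [h1, one_mul]

lemma conj_bC : (starRingEnd ℂ) bC = 1 - bC := by
  rw [bC_eq]
  have : (1:ℂ) - ep^45 = ep^9 := by rw [← bC_eq, bC_eq']; ring
  rw [this, map_pow, conj_ep, ← pow_mul]
  have h2 := ep_prim.pow_eq_one
  calc ep^(53*45) = (ep^54)^44 * ep^9 := by ring
    _ = _ := by rw [h2, one_pow, one_mul]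

/-! ### Classification of critical points in torus coordinates -/

lemma w_class {x y z x' y' z' : ℂ} (hx : x*x' = 1) (hy : y*y' = 1) (hz : z*z'=1)
    (hxyz : x*y*z = 1) (h1 : x - x' = z - z') (h2 : y - y' = z - z') :
    (x = y ∧ y = z ∧ z^3 = 1) ∨ (x = 1 ∧ y = -1 ∧ z = -1) ∨ (x = -1 ∧ y = 1 ∧ z = -1) ∨
      (x = -1 ∧ y = -1 ∧ z = 1) := by
  have x0 : x ≠ 0 := left_ne_zero_of_mul_eq_one hx
  have y0 : y ≠ 0 := left_ne_zero_of_mul_eq_one hy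
  have z0 : z ≠ 0 := left_ne_zero_of_mul_eq_one hz
  have a1 : (x - z) * (x*z + 1) = 0 := by
    linear_combination x*z*h1 + z * hx - x*hz
  have a2 : (y - z) * (y*z + 1) = 0 := by
    linear_combination y*z*h2 + z * hy - y*hz
  have a3 : (x - y) * (x*y + 1) = 0 := by
    linear_combination x*y*(h1-h2) + y * hx - x*hy
  have key : ∀ {p q r : ℂ}, p*q*r = 1 → p*q+1=0 → r = -1 := by
    intro p q r h h'
    linear_combination -h + r*h'
  have sq : ∀ {p q : ℂ}, (p-q)*(p*q+1) = 0 → p = -1 → q = 1 ∨ q = -1 := by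
    intro p q h hp
    subst hp
    have : (q-1)*(q+1) = 0 := by linear_combination h
    rcases mul_eq_zero.1 this with h | h
    · left; linear_combination h
    · right; linear_combination h
  rcases mul_eq_zero.1 a1 with b1 | b1
  · rcases mul_eq_zero.1 a2 with b2 | b2
    · left
      have e1 : x = z := by linear_combination b1
      have e2 : y = z := by linear_combination b2
      subst e1; subst e2
      exact ⟨rfl, rfl, by linear_combination hxyz⟩
    · have hx1 : x = -1 := key (p := y) (q := z) (by linear_combination hxyz) b2
      have hz1 : z = -1 := by linear_combination hx1 - b1
      subst hx1; subst hz1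
      right; right; left
      exact ⟨rfl, by linear_combination hxyz, rfl⟩
  · have hy1 : y = -1 := key (p := x) (q := z) (by linear_combination hxyz) b1
    right
    rcases sq a2 hy1 with hz1 | hz1
    · subst hy1; subst hz1
      right; right
      exact ⟨by linear_combination -hxyz, rfl, rfl⟩
    · subst hy1; subst hz1
      left
      exact ⟨by linear_combination hxyz, rfl, rfl⟩

lemma crit_torus {a b c : ℂ} (h : a*b*c = 1) (hgu : gGu (a+b+c) (a*b+b*c+c*a) = 0)
    (hgv : gGv (a+b+c) (a*b+b*c+c*a) = 0) :
    (∀ x y z : ℂ, x = -bC*a^9 → y = -bC*b^9 → z = -bC*c^9 →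
      (x = y ∧ y = z ∧ z^3 = 1) ∨ (x = 1 ∧ y = -1 ∧ z = -1) ∨ (x = -1 ∧ y = 1 ∧ z = -1) ∨
      (x = -1 ∧ y = -1 ∧ z = 1)) ∧
    gGuv (a+b+c) (a*b+b*c+c*a)^2
      - gGuu (a+b+c) (a*b+b*c+c*a) * gGvv (a+b+c) (a*b+b*c+c*a) ≠ 0 ∧
    a ≠ b ∧ b ≠ c ∧ a ≠ c := by
  have d1 := gG_d1 h
  have d2 := gG_d2 h
  have d11 := gG_d11 h hgu hgv
  have d22 := gG_d22 h hgu hgv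
  have d12 := gG_d12 h hgu hgv
  rw [hgu, hgv] at d1 d2
  generalize gGuu (a+b+c) (a*b+b*c+c*a) = U at *
  generalize gGuv (a+b+c) (a*b+b*c+c*a) = V at *
  generalize gGvv (a+b+c) (a*b+b*c+c*a) = W at *
  have h9 : a^9*b^9*c^9 = 1 := by rw [← mul_pow, ← mul_pow, h, one_pow]
  obtain ⟨x, hx⟩ : ∃ x, x = -bC*a^9 := ⟨_, rfl⟩
  obtain ⟨y, hy⟩ : ∃ x, x = -bC*b^9 := ⟨_, rfl⟩
  obtain ⟨z, hz⟩ : ∃ x, x = -bC*c^9 := ⟨_, rfl⟩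
  obtain ⟨x', hx'⟩ : ∃ x, x = -(1-bC)*(b*c)^9 := ⟨_, rfl⟩
  obtain ⟨y', hy'⟩ : ∃ x, x = -(1-bC)*(c*a)^9 := ⟨_, rfl⟩
  obtain ⟨z', hz'⟩ : ∃ x, x = -(1-bC)*(a*b)^9 := ⟨_, rfl⟩
  have bb : bC * (1-bC) = 1 := by linear_combination -bC_sq
  have bcube : bC^3 = -1 := by linear_combination (bC+1)*bC_sq
  have xx : x*x' = 1 := by
    rw [hx, hx', mul_pow]; linear_combination a^9*b^9*c^9*bb + h9
  have yy : y*y' = 1 := by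
    rw [hy, hy', mul_pow]; linear_combination a^9*b^9*c^9*bb + h9
  have zz : z*z' = 1 := by
    rw [hz, hz', mul_pow]; linear_combination a^9*b^9*c^9*bb + h9
  have xyz : x*y*z = 1 := by
    rw [hx, hy, hz]; linear_combination -a^9*b^9*c^9*bcube + h9
  have k1 : x - x' = z - z' := by
    rw [hx, hz, hx', hz']; linear_combination -d1/9
  have k2 : y - y' = z - z' := by
    rw [hy, hz, hy', hz']; linear_combination -d2/9
  have cl := w_class xx yy zz xyz k1 k2
  have e11 : U * (a-c)^2 + 2*V*(b*(a-c)^2) + W*(b*(a-c))^2 = 81*(x+x'+z+z') := by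
    rw [hx, hz, hx', hz']; linear_combination d11
  have e22 : U * (b-c)^2 + 2*V*(a*(b-c)^2) + W*(a*(b-c))^2 = 81*(y+y'+z+z') := by
    rw [hy, hz, hy', hz']; linear_combination d22
  have e12 : U * ((a-c)*(b-c)) + V*((a-c)*(a*(b-c)) + (b-c)*(b*(a-c)))
      + W*((b*(a-c))*(a*(b-c))) = 81*(z+z') := by
    rw [hz, hz']; linear_combination d12
  have edet : (U*W - V^2) * ((a-c)*(b-c)*(a-b))^2
      = 81^2 * ((x+x')*(y+y') + (x+x')*(z+z') + (y+y')*(z+z')) := by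
    calc (U*W - V^2) * ((a-c)*(b-c)*(a-b))^2
        = (U * (a-c)^2 + 2*V*(b*(a-c)^2) + W*(b*(a-c))^2)
          * (U * (b-c)^2 + 2*V*(a*(b-c)^2) + W*(a*(b-c))^2)
          - (U * ((a-c)*(b-c)) + V*((a-c)*(a*(b-c)) + (b-c)*(b*(a-c)))
      + W*((b*(a-c))*(a*(b-c))))^2 := by ring
      _ = _ := by rw [e11, e22, e12]; ring
  have inv1 : ∀ {p q : ℂ}, p*q = 1 → p = 1 → q = 1 := by
    intro p q h1 h2; rw [h2] at h1; linear_combination h1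
  have inv2 : ∀ {p q : ℂ}, p*q = 1 → p = -1 → q = -1 := by
    intro p q h1 h2; rw [h2] at h1; linear_combination -h1
  have nz : (U*W - V^2) * ((a-c)*(b-c)*(a-b))^2 ≠ 0 := by
    rw [edet]
    rcases cl with ⟨r1, r2, r3⟩ | ⟨r1, r2, r3⟩ | ⟨r1, r2, r3⟩ | ⟨r1, r2, r3⟩
    · have z0 : z ≠ 0 := left_ne_zero_of_mul_eq_one zz
      have xz : x' = z' := by
        apply mul_left_cancel₀ z0; rw [zz, ← xx, r1, r2]
      have yz : y' = z' := by
        apply mul_left_cancel₀ z0; rw [zz, ← yy, r2]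
      have z2 : z' = z^2 := by
        apply mul_left_cancel₀ z0; rw [zz, ← r3]; ring
      rw [r1, r2, xz, yz, z2]
      have f : (z-1)*(z^2+z+1) = 0 := by linear_combination r3
      rcases mul_eq_zero.1 f with f | f
      · have : z = 1 := by linear_combination f
        rw [this]; norm_num
      · have : z + z^2 = -1 := by linear_combination f
        rw [this]; norm_num
    · rw [inv1 xx r1, inv2 yy r2, inv2 zz r3, r1, r2, r3]; norm_num
    · rw [inv2 xx r1, inv1 yy r2, inv2 zz r3, r1, r2, r3]; norm_num
    · rw [inv2 xx r1, inv2 yy r2, inv1 zz r3, r1, r2, r3]; norm_num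
  refine ⟨?_, ?_, ?_, ?_, ?_⟩
  · intro x1 y1 z1 g1 g2 g3
    rw [g1, g2, g3, ← hx, ← hy, ← hz]
    exact cl
  · intro e
    apply nz
    have : U*W - V^2 = 0 := by linear_combination -e
    rw [this, zero_mul]
  · rintro rfl; apply nz; ring
  · rintro rfl; apply nz; ring
  · rintro rfl; apply nz; ring

lemma exists_torus (u v : ℂ) : ∃ a b c : ℂ, a*b*c = 1 ∧ u = a+b+c ∧ v = a*b+b*c+c*a := by
  obtain ⟨a, ha⟩ : ∃ a : ℂ, a^3 - u*a^2 + v*a - 1 = 0 := by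
    have hd : (Polynomial.C 1 * Polynomial.X^3 + Polynomial.C (-u) * Polynomial.X^2
      + Polynomial.C v * Polynomial.X + Polynomial.C (-1) : Polynomial ℂ).degree = 3 :=
      Polynomial.degree_cubic one_ne_zero
    obtain ⟨a, ha⟩ := IsAlgClosed.exists_root _ (by rw [hd]; norm_num)
    refine ⟨a, ?_⟩
    simp only [Polynomial.IsRoot, Polynomial.eval_add, Polynomial.eval_mul, Polynomial.eval_C,
      Polynomial.eval_pow, Polynomial.eval_X] at ha
    linear_combination ha
  obtain ⟨d, hd⟩ := IsAlgClosed.exists_eq_mul_self ((u-a)^2 - 4*(v - a*(u-a)))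
  refine ⟨a, ((u-a)+d)/2, ((u-a)-d)/2, ?_, by ring, ?_⟩
  · linear_combination a/4*hd + ha
  · linear_combination -hd/4

/-! ### The index sets -/

def thd (k l : ℕ) : ℕ := (108 - k - l) % 54

def cnd (i : Fin 3) (k l m : ℕ) : Prop :=
  match i with
  | 0 => (k % 6 = 4 ∧ l % 6 = 1 ∧ m % 6 = 1) ∨ (k % 6 = 1 ∧ l % 6 = 4 ∧ m % 6 = 1) ∨
      (k % 6 = 1 ∧ l % 6 = 1 ∧ m % 6 = 4)
  | 1 => k % 6 = 4 ∧ l % 6 = 4 ∧ m % 6 = 4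
  | 2 => (k % 6 = 0 ∧ l % 6 = 0 ∧ m % 6 = 0) ∨ (k % 6 = 2 ∧ l % 6 = 2 ∧ m % 6 = 2)

instance (i : Fin 3) (k l m : ℕ) : Decidable (cnd i k l m) := by
  unfold cnd; split <;> infer_instance

def vv (i : Fin 3) : ℝ := match i with
  | 0 => 0
  | 1 => 8
  | 2 => -1

@[irreducible] def TT (i : Fin 3) : Finset (ℕ × ℕ) :=
  (Finset.range 54 ×ˢ Finset.range 54).filter
    fun q => q.1 < q.2 ∧ q.2 < thd q.1 q.2 ∧ cnd i q.1 q.2 (thd q.1 q.2)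

lemma card_TT0 : (TT 0).card = 36 := by unfold TT; decide +kernel
lemma card_TT1 : (TT 1).card = 9 := by unfold TT; decide +kernel
lemma card_TT2 : (TT 2).card = 19 := by unfold TT; decide +kernel

def ptC (q : ℕ × ℕ) : ℂ := ep^q.1 + ep^q.2 + ep^(thd q.1 q.2)

lemma cnd_perm (i : Fin 3) (k l m : ℕ) : (cnd i k l m → cnd i l k m) ∧
    (cnd i k l m → cnd i k m l) := by
  unfold cnd
  split <;> constructor <;> intro h <;> tauto

lemma mem_TT_of {i : Fin 3} {k l m : ℕ} (hk : k < 54) (hl : l < 54) (hm : m < 54)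
    (hkl : k < l) (hlm : l < m) (hs : (k+l+m) % 54 = 0) (hc : cnd i k l m) :
    ∃ q ∈ TT i, ptC q = ep^k + ep^l + ep^m := by
  have ht : thd k l = m := by unfold thd; omega
  refine ⟨(k,l), ?_, by simp [ptC, ht]⟩
  simp only [TT, Finset.mem_filter, Finset.mem_product, Finset.mem_range]
  exact ⟨⟨hk, hl⟩, hkl, by rw [ht]; exact hlm, by rw [ht]; exact hc⟩

lemma mem_TT_of' {i : Fin 3} {k l m : ℕ} (hk : k < 54) (hl : l < 54) (hm : m < 54)
    (hkl : k ≠ l) (hlm : l ≠ m) (hkm : k ≠ m) (hs : (k+l+m) % 54 = 0) (hc : cnd i k l m) :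
    ∃ q ∈ TT i, ptC q = ep^k + ep^l + ep^m := by
  have P1 : cnd i l k m := (cnd_perm i k l m).1 hc
  have P2 : cnd i k m l := (cnd_perm i k l m).2 hc
  have P3 : cnd i l m k := (cnd_perm i l k m).2 P1
  have P4 : cnd i m k l := (cnd_perm i k m l).1 P2
  have P5 : cnd i m l k := (cnd_perm i l m k).1 P3
  rcases lt_or_gt_of_ne hkl with h1 | h1 <;> rcases lt_or_gt_of_ne hlm with h2 | h2 <;>
    rcases lt_or_gt_of_ne hkm with h3 | h3
  · exact mem_TT_of hk hl hm h1 h2 hs hc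
  · omega
  · obtain ⟨q, hq, e⟩ := mem_TT_of hk hm hl h3 h2 (by omega) P2
    exact ⟨q, hq, by rw [e]; ring⟩
  · obtain ⟨q, hq, e⟩ := mem_TT_of hm hk hl h3 h1 (by omega) P4
    exact ⟨q, hq, by rw [e]; ring⟩
  · obtain ⟨q, hq, e⟩ := mem_TT_of hl hk hm h1 h3 (by omega) P1
    exact ⟨q, hq, by rw [e]; ring⟩
  · obtain ⟨q, hq, e⟩ := mem_TT_of hl hm hk h2 h3 (by omega) P3
    exact ⟨q, hq, by rw [e]; ring⟩
  · omega
  · obtain ⟨q, hq, e⟩ := mem_TT_of hm hl hk h2 h1 (by omega) P5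
    exact ⟨q, hq, by rw [e]; ring⟩

lemma ep_pow_eq {i j : ℕ} (h : ep^i = ep^j) : i % 54 = j % 54 := by
  apply ep_prim.pow_inj (Nat.mod_lt _ (by norm_num)) (Nat.mod_lt _ (by norm_num))
  have key : ∀ n : ℕ, ep^(n % 54) = ep^n := by
    intro n
    conv_rhs => rw [← Nat.div_add_mod n 54, pow_add, pow_mul, ep_prim.pow_eq_one, one_pow, one_mul]
  rw [key, key, h]

lemma w_exp (k : ℕ) : -bC * (ep^k)^9 = ep^(9*k+18) := by
  rw [bC_eq]
  linear_combination (-ep^(9*k+18)) * ep27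

lemma crit_fwd {u v : ℂ} (hgu : gGu u v = 0) (hgv : gGv u v = 0) :
    (∃ i, ∃ q ∈ TT i, ptC q = u) ∧ gGuv u v^2 - gGuu u v * gGvv u v ≠ 0 := by
  obtain ⟨a, b, c, h, rfl, rfl⟩ := exists_torus u v
  obtain ⟨cl, nd, hab, hbc, hac⟩ := crit_torus h hgu hgv
  refine ⟨?_, nd⟩
  have cl := cl _ _ _ rfl rfl rfl
  have six : (-bC*a^9)^6 = 1 ∧ (-bC*b^9)^6 = 1 ∧ (-bC*c^9)^6 = 1 := by
    rcases cl with ⟨r1, r2, r3⟩ | ⟨r1, r2, r3⟩ | ⟨r1, r2, r3⟩ | ⟨r1, r2, r3⟩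
    · rw [r1, r2]
      have : (-bC*c^9)^6 = 1 := by
        rw [show 6 = 3*2 from rfl, pow_mul, r3, one_pow]
      exact ⟨this, this, this⟩
    all_goals rw [r1, r2, r3]; norm_num
  have b6 : bC^6 = 1 := by
    have bcube : bC^3 = -1 := by linear_combination (bC+1)*bC_sq
    linear_combination (bC^3 - 1) * bcube
  have key : ∀ {s : ℂ}, (-bC*s^9)^6 = 1 → ∃ k < 54, ep^k = s := by
    intro s hs
    apply ep_prim.eq_pow_of_pow_eq_one
    linear_combination hs - s^54*b6
  obtain ⟨k, hk, rfl⟩ := key six.1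
  obtain ⟨l, hl, rfl⟩ := key six.2.1
  obtain ⟨m, hm, rfl⟩ := key six.2.2
  have hs : (k+l+m) % 54 = 0 := by
    have : ep^(k+l+m) = ep^0 := by rw [pow_zero, ← h]; ring
    exact ep_pow_eq this
  have nkl : k ≠ l := fun e => hab (by rw [e])
  have nlm : l ≠ m := fun e => hbc (by rw [e])
  have nkm : k ≠ m := fun e => hac (by rw [e])
  rw [w_exp, w_exp, w_exp] at cl
  have g1 : ∀ {k}, ep^(9*k+18) = 1 → k % 6 = 4 := by
    intro k hk
    have := ep_pow_eq (j := 0) (by rw [hk, pow_zero])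
    omega
  have g2 : ∀ {k}, ep^(9*k+18) = -1 → k % 6 = 1 := by
    intro k hk
    have := ep_pow_eq (j := 27) (by rw [hk, ep27])
    omega
  have : ∃ i, cnd i k l m := by
    rcases cl with ⟨r1, r2, r3⟩ | ⟨r1, r2, r3⟩ | ⟨r1, r2, r3⟩ | ⟨r1, r2, r3⟩
    · have r1 := ep_pow_eq r1
      have r2 := ep_pow_eq r2
      rw [← pow_mul] at r3
      have r3 := ep_pow_eq (j := 0) (by rw [r3, pow_zero])
      have : m % 6 = 0 ∨ m % 6 = 2 ∨ m % 6 = 4 := by omega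
      rcases this with hh | hh | hh
      · exact ⟨2, Or.inl (by omega)⟩
      · exact ⟨2, Or.inr (by omega)⟩
      · refine ⟨1, ?_⟩
        show k % 6 = 4 ∧ l % 6 = 4 ∧ m % 6 = 4
        omega
    · exact ⟨0, Or.inl ⟨g1 r1, g2 r2, g2 r3⟩⟩
    · exact ⟨0, Or.inr (Or.inl ⟨g2 r1, g1 r2, g2 r3⟩)⟩
    · exact ⟨0, Or.inr (Or.inr ⟨g2 r1, g2 r2, g1 r3⟩)⟩
  obtain ⟨i, hi⟩ := this
  exact ⟨i, mem_TT_of' hk hl hm nkl nlm nkm hs hi⟩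

lemma ep_w (k r : ℕ) (h : k % 6 = r) : (ep^k)^9 = (ep^9)^r := by
  have e : k = 6 * (k/6) + r := by omega
  rw [e, ← pow_mul, ← pow_mul]
  calc ep^((6*(k/6)+r)*9) = (ep^54)^(k/6) * ep^(9*r) := by ring
    _ = _ := by rw [ep_prim.pow_eq_one, one_pow, one_mul]

lemma TT_spec {i : Fin 3} {q : ℕ × ℕ} (hq : q ∈ TT i) : ∃ k l m, k < l ∧ l < m ∧ m < 54 ∧
    q = (k,l) ∧ thd k l = m ∧ cnd i k l m ∧ ep^k*ep^l*ep^m = 1 ∧ ptC q = ep^k+ep^l+ep^m ∧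
    (starRingEnd ℂ) (ptC q) = ep^k*ep^l+ep^l*ep^m+ep^m*ep^k := by
  obtain ⟨k, l⟩ := q
  simp only [TT, Finset.mem_filter, Finset.mem_product, Finset.mem_range] at hq
  obtain ⟨⟨hk, hl⟩, h1, h2, h3⟩ := hq
  have hs : (k + l + thd k l) % 54 = 0 ∧ thd k l < 54 := by unfold thd; omega
  obtain ⟨m, hm⟩ : ∃ m, thd k l = m := ⟨_, rfl⟩
  rw [hm] at h2 h3 hs
  have prod : ep^k*ep^l*ep^m = 1 := by
    rw [← pow_add, ← pow_add, ← Nat.div_add_mod (k+l+m) 54, hs.1, add_zero, pow_mul,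
      ep_prim.pow_eq_one, one_pow]
  refine ⟨k, l, m, h1, h2, hs.2, rfl, hm, h3, prod, by simp [ptC, hm], ?_⟩
  have cj : ∀ n : ℕ, (ep^53)^n * ep^n = 1 := by
    intro n
    rw [← mul_pow, ← pow_succ, ep_prim.pow_eq_one, one_pow]
  simp only [ptC, hm, map_add, map_pow, conj_ep]
  have ck := cj k
  have cl := cj l
  have cm := cj m
  generalize (ep^53)^k = A at *
  generalize (ep^53)^l = B at *
  generalize (ep^53)^m = C at *
  generalize ep^k = a at *
  generalize ep^l = b at *
  generalize ep^m = c at *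
  linear_combination -(A+B+C)*prod + b*c*ck + c*a*cl + a*b*cm

lemma crit_bwd {i : Fin 3} {q : ℕ × ℕ} (hq : q ∈ TT i) :
    gGu (ptC q) ((starRingEnd ℂ) (ptC q)) = 0 ∧ gGv (ptC q) ((starRingEnd ℂ) (ptC q)) = 0 ∧
    gG (ptC q) ((starRingEnd ℂ) (ptC q)) = (vv i : ℝ) := by
  obtain ⟨k, l, m, hkl, hlm, hm, -, -, hc, h, e1, e2⟩ := TT_spec hq
  rw [e2, e1]
  have nab : ep^k ≠ ep^l := fun e => by
    have := ep_prim.pow_inj (by omega) (by omega) e; omega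
  have nbc : ep^l ≠ ep^m := fun e => by
    have := ep_prim.pow_inj (by omega) (by omega) e; omega
  have nac : ep^k ≠ ep^m := fun e => by
    have := ep_prim.pow_inj (by omega) (by omega) e; omega
  have vals : ∀ n r, n % 6 = r → (ep^n)^9 = (ep^9)^r := ep_w
  have h9 : (ep^k)^9*(ep^l)^9*(ep^m)^9 = 1 := by rw [← mul_pow, ← mul_pow, h, one_pow]
  have d1 := gG_d1 h
  have d2 := gG_d2 h
  have g0 := gG_torus h
  rw [mul_pow, mul_pow] at d1 d2
  rw [mul_pow, mul_pow, mul_pow] at g0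
  have t2 := ep9_sq
  have red : ((ep^9)^0 = 1 ∧ (ep^9)^1 = ep^9) ∧ (ep^9)^2 = ep^9 - 1 ∧ (ep^9)^4 = - ep^9 := by
    refine ⟨⟨pow_zero _, pow_one _⟩, t2, ?_⟩
    linear_combination ((ep^9)^2 + ep^9) * t2
  have fin : gG (ep^k+ep^l+ep^m) (ep^k*ep^l+ep^l*ep^m+ep^m*ep^k) = (vv i : ℝ) ∧
     (gGu (ep^k+ep^l+ep^m) (ep^k*ep^l+ep^l*ep^m+ep^m*ep^k)
       + gGv (ep^k+ep^l+ep^m) (ep^k*ep^l+ep^l*ep^m+ep^m*ep^k) * ep^l) * (ep^k-ep^m) = 0 ∧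
     (gGu (ep^k+ep^l+ep^m) (ep^k*ep^l+ep^l*ep^m+ep^m*ep^k)
       + gGv (ep^k+ep^l+ep^m) (ep^k*ep^l+ep^l*ep^m+ep^m*ep^k) * ep^k) * (ep^l-ep^m) = 0 := by
    rw [d1, d2, g0]
    clear d1 d2 g0
    rw [bC_eq']
    unfold cnd at hc
    unfold vv
    split at hc
    · rcases hc with ⟨r1, r2, r3⟩ | ⟨r1, r2, r3⟩ | ⟨r1, r2, r3⟩ <;>
      · rw [vals _ _ r1, vals _ _ r2, vals _ _ r3, red.2.2, red.1.2]
        generalize ep^9 = t at *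
        push_cast
        refine ⟨?_, ?_, ?_⟩ <;> grind
    · obtain ⟨r1, r2, r3⟩ := hc
      rw [vals _ _ r1, vals _ _ r2, vals _ _ r3, red.2.2]
      generalize ep^9 = t at *
      push_cast
      refine ⟨?_, ?_, ?_⟩ <;> grind
    · rcases hc with ⟨r1, r2, r3⟩ | ⟨r1, r2, r3⟩ <;>
      · rw [vals _ _ r1, vals _ _ r2, vals _ _ r3]
        generalize ep^9 = t at *
        push_cast
        refine ⟨?_, ?_, ?_⟩ <;> grind
  obtain ⟨f0, f1, f2⟩ := fin
  have f1 := (mul_eq_zero.1 f1).resolve_right (sub_ne_zero.2 nac)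
  have f2 := (mul_eq_zero.1 f2).resolve_right (sub_ne_zero.2 nbc)
  have f3 : gGv (ep^k+ep^l+ep^m) (ep^k*ep^l+ep^l*ep^m+ep^m*ep^k) = 0 := by
    have : gGv (ep^k+ep^l+ep^m) (ep^k*ep^l+ep^l*ep^m+ep^m*ep^k) * (ep^k - ep^l) = 0 := by
      linear_combination f2 - f1
    exact (mul_eq_zero.1 this).resolve_right (sub_ne_zero.2 nab)
  refine ⟨?_, f3, f0⟩
  rw [f3] at f1
  linear_combination f1

lemma ptC_inj {i j : Fin 3} {q q' : ℕ × ℕ} (hq : q ∈ TT i) (hq' : q' ∈ TT j)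
    (h : ptC q = ptC q') : q = q' := by
  obtain ⟨k, l, m, hkl, hlm, hm, rfl, -, -, p1, e1, e2⟩ := TT_spec hq
  obtain ⟨k', l', m', hkl', hlm', hm', rfl, -, -, p1', e1', e2'⟩ := TT_spec hq'
  rw [h, e1'] at e1
  rw [h, e2'] at e2
  have key : ∀ n < 54, (ep^n - ep^k)*(ep^n-ep^l)*(ep^n-ep^m) = 0 → n = k' ∨ n = l' ∨ n = m' := by
    intro n hn h0
    have : (ep^n - ep^k')*((ep^n-ep^l')*(ep^n-ep^m')) = 0 := by
      linear_combination h0 - (ep^n)^2 * e1 + ep^n * e2 - p1' + p1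
    rcases mul_eq_zero.1 this with h | h
    · left; exact ep_prim.pow_inj (by omega) (by omega) (sub_eq_zero.1 h)
    rcases mul_eq_zero.1 h with h | h
    · right; left; exact ep_prim.pow_inj (by omega) (by omega) (sub_eq_zero.1 h)
    · right; right; exact ep_prim.pow_inj (by omega) (by omega) (sub_eq_zero.1 h)
  have a1 := key k (by omega) (by ring)
  have a2 := key l (by omega) (by ring)
  have a3 := key m (by omega) (by ring)
  ext
  · show k = k'
    omega
  · show l = l'
    omega

/-! ### Calculus -/

lemma nP_deriv {p q : ℝ → ℂ} {p' q' : ℂ} {x : ℝ} (hp : HasDerivAt p p' x)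
    (hq : HasDerivAt q q' x) :
    HasDerivAt (fun t => nP (p t) (q t) 1)
      (nPu (p x) (q x) 1 * p' + nPv (p x) (q x) 1 * q') x := by
  have e : (fun t => nP (p t) (q t) 1) = fun t => (1)*((p t)^9*(q t)^0) + (-9)*((p t)^7*(q t)^1) + (9)*((p t)^6*(q t)^0) + (27)*((p t)^5*(q t)^2) + (-45)*((p t)^4*(q t)^1) + (-30)*((p t)^3*(q t)^3) + (18)*((p t)^3*(q t)^0) + (54)*((p t)^2*(q t)^2) + (9)*((p t)^1*(q t)^4) + (-27)*((p t)^1*(q t)^1) + (-9)*((p t)^0*(q t)^3) + (3)*((p t)^0*(q t)^0) := by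
    funext t; unfold nP; ring
  rw [e]
  refine HasDerivAt.congr_deriv ((((((((((((((hp.fun_pow 9).fun_mul (hq.fun_pow 0)).const_mul (1 : ℂ)).fun_add
    (((hp.fun_pow 7).fun_mul (hq.fun_pow 1)).const_mul (-9 : ℂ))).fun_add
    (((hp.fun_pow 6).fun_mul (hq.fun_pow 0)).const_mul (9 : ℂ))).fun_add
    (((hp.fun_pow 5).fun_mul (hq.fun_pow 2)).const_mul (27 : ℂ))).fun_add
    (((hp.fun_pow 4).fun_mul (hq.fun_pow 1)).const_mul (-45 : ℂ))).fun_add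
    (((hp.fun_pow 3).fun_mul (hq.fun_pow 3)).const_mul (-30 : ℂ))).fun_add
    (((hp.fun_pow 3).fun_mul (hq.fun_pow 0)).const_mul (18 : ℂ))).fun_add
    (((hp.fun_pow 2).fun_mul (hq.fun_pow 2)).const_mul (54 : ℂ))).fun_add
    (((hp.fun_pow 1).fun_mul (hq.fun_pow 4)).const_mul (9 : ℂ))).fun_add
    (((hp.fun_pow 1).fun_mul (hq.fun_pow 1)).const_mul (-27 : ℂ))).fun_add
    (((hp.fun_pow 0).fun_mul (hq.fun_pow 3)).const_mul (-9 : ℂ))).fun_add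
    (((hp.fun_pow 0).fun_mul (hq.fun_pow 0)).const_mul (3 : ℂ))) ?_
  unfold nPu nPv
  norm_num
  ring

lemma nPu_deriv {p q : ℝ → ℂ} {p' q' : ℂ} {x : ℝ} (hp : HasDerivAt p p' x)
    (hq : HasDerivAt q q' x) :
    HasDerivAt (fun t => nPu (p t) (q t) 1)
      (nPuu (p x) (q x) 1 * p' + nPuv (p x) (q x) 1 * q') x := by
  have e : (fun t => nPu (p t) (q t) 1) = fun t => (9)*((p t)^8*(q t)^0) + (-63)*((p t)^6*(q t)^1) + (54)*((p t)^5*(q t)^0) + (135)*((p t)^4*(q t)^2) + (-180)*((p t)^3*(q t)^1) + (-90)*((p t)^2*(q t)^3) + (54)*((p t)^2*(q t)^0) + (108)*((p t)^1*(q t)^2) + (9)*((p t)^0*(q t)^4) + (-27)*((p t)^0*(q t)^1) := by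
    funext t; unfold nPu; ring
  rw [e]
  refine HasDerivAt.congr_deriv ((((((((((((hp.fun_pow 8).fun_mul (hq.fun_pow 0)).const_mul (9 : ℂ)).fun_add
    (((hp.fun_pow 6).fun_mul (hq.fun_pow 1)).const_mul (-63 : ℂ))).fun_add
    (((hp.fun_pow 5).fun_mul (hq.fun_pow 0)).const_mul (54 : ℂ))).fun_add
    (((hp.fun_pow 4).fun_mul (hq.fun_pow 2)).const_mul (135 : ℂ))).fun_add
    (((hp.fun_pow 3).fun_mul (hq.fun_pow 1)).const_mul (-180 : ℂ))).fun_add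
    (((hp.fun_pow 2).fun_mul (hq.fun_pow 3)).const_mul (-90 : ℂ))).fun_add
    (((hp.fun_pow 2).fun_mul (hq.fun_pow 0)).const_mul (54 : ℂ))).fun_add
    (((hp.fun_pow 1).fun_mul (hq.fun_pow 2)).const_mul (108 : ℂ))).fun_add
    (((hp.fun_pow 0).fun_mul (hq.fun_pow 4)).const_mul (9 : ℂ))).fun_add
    (((hp.fun_pow 0).fun_mul (hq.fun_pow 1)).const_mul (-27 : ℂ))) ?_
  unfold nPuu nPuv
  norm_num
  ring

lemma nPv_deriv {p q : ℝ → ℂ} {p' q' : ℂ} {x : ℝ} (hp : HasDerivAt p p' x)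
    (hq : HasDerivAt q q' x) :
    HasDerivAt (fun t => nPv (p t) (q t) 1)
      (nPuv (p x) (q x) 1 * p' + nPvv (p x) (q x) 1 * q') x := by
  have e : (fun t => nPv (p t) (q t) 1) = fun t => (-9)*((p t)^7*(q t)^0) + (54)*((p t)^5*(q t)^1) + (-45)*((p t)^4*(q t)^0) + (-90)*((p t)^3*(q t)^2) + (108)*((p t)^2*(q t)^1) + (36)*((p t)^1*(q t)^3) + (-27)*((p t)^1*(q t)^0) + (-27)*((p t)^0*(q t)^2) := by
    funext t; unfold nPv; ring
  rw [e]
  refine HasDerivAt.congr_deriv ((((((((((hp.fun_pow 7).fun_mul (hq.fun_pow 0)).const_mul (-9 : ℂ)).fun_add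
    (((hp.fun_pow 5).fun_mul (hq.fun_pow 1)).const_mul (54 : ℂ))).fun_add
    (((hp.fun_pow 4).fun_mul (hq.fun_pow 0)).const_mul (-45 : ℂ))).fun_add
    (((hp.fun_pow 3).fun_mul (hq.fun_pow 2)).const_mul (-90 : ℂ))).fun_add
    (((hp.fun_pow 2).fun_mul (hq.fun_pow 1)).const_mul (108 : ℂ))).fun_add
    (((hp.fun_pow 1).fun_mul (hq.fun_pow 3)).const_mul (36 : ℂ))).fun_add
    (((hp.fun_pow 1).fun_mul (hq.fun_pow 0)).const_mul (-27 : ℂ))).fun_add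
    (((hp.fun_pow 0).fun_mul (hq.fun_pow 2)).const_mul (-27 : ℂ))) ?_
  unfold nPuv nPvv
  norm_num
  ring

lemma gG_deriv {p q : ℝ → ℂ} {p' q' : ℂ} {x : ℝ} (hp : HasDerivAt p p' x)
    (hq : HasDerivAt q q' x) :
    HasDerivAt (fun t => gG (p t) (q t))
      (gGu (p x) (q x) * p' + gGv (p x) (q x) * q') x := by
  have h1 := (nP_deriv hp hq).const_mul (bC)
  have h2 := (nP_deriv hq hp).const_mul (1 - bC)
  have h3 := (h1.const_sub 2).fun_sub h2
  refine HasDerivAt.congr_deriv h3 ?_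
  unfold gGu gGv
  ring

lemma gGu_deriv {p q : ℝ → ℂ} {p' q' : ℂ} {x : ℝ} (hp : HasDerivAt p p' x)
    (hq : HasDerivAt q q' x) :
    HasDerivAt (fun t => gGu (p t) (q t))
      (gGuu (p x) (q x) * p' + gGuv (p x) (q x) * q') x := by
  have h1 := (nPu_deriv hp hq).const_mul (-bC)
  have h2 := (nPv_deriv hq hp).const_mul (1 - bC)
  have h3 := h1.fun_sub h2
  refine HasDerivAt.congr_deriv h3 ?_
  unfold gGuu gGuv
  ring

lemma gGv_deriv {p q : ℝ → ℂ} {p' q' : ℂ} {x : ℝ} (hp : HasDerivAt p p' x)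
    (hq : HasDerivAt q q' x) :
    HasDerivAt (fun t => gGv (p t) (q t))
      (gGuv (p x) (q x) * p' + gGvv (p x) (q x) * q') x := by
  have h1 := (nPv_deriv hp hq).const_mul (-bC)
  have h2 := (nPu_deriv hq hp).const_mul (1 - bC)
  have h3 := h1.fun_sub h2
  refine HasDerivAt.congr_deriv h3 ?_
  unfold gGuv gGvv
  ring

lemma J9R_eq (x y : ℝ) :
    ((J9R x y : ℝ) : ℂ) = gG ((x:ℂ) + y * Complex.I) ((x:ℂ) - y * Complex.I) := by
  unfold J9R
  have h1 := Complex.add_conj (j9 ((x:ℂ) + y * Complex.I) ((x:ℂ) - y * Complex.I))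
  push_cast at h1 ⊢
  rw [← h1]
  have e1 : (starRingEnd ℂ) ((x:ℂ) + y * Complex.I) = (x:ℂ) - y * Complex.I := by
    simp [sub_eq_add_neg]
  have e2 : (starRingEnd ℂ) ((x:ℂ) - y * Complex.I) = (x:ℂ) + y * Complex.I := by
    simp [sub_eq_add_neg]
  have e3 : (starRingEnd ℂ) (27/2 : ℂ) = 27/2 := by
    rw [map_div₀, map_ofNat, map_ofNat]
  unfold j9
  simp only [map_add, map_sub, map_mul, map_pow, map_ofNat, conj_bC, e3]
  rw [← map_mul, ← map_add, ← map_sub, e1, e2]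
  generalize (x:ℂ) + y * Complex.I = u
  generalize (x:ℂ) - y * Complex.I = v
  unfold gG nP
  ring

lemma real_deriv {f : ℝ → ℝ} {g : ℝ → ℂ} {c : ℂ} {x : ℝ} (h : ∀ t, ((f t : ℝ) : ℂ) = g t)
    (hg : HasDerivAt g c x) : HasDerivAt f c.re x ∧ ((c.re : ℝ) : ℂ) = c := by
  have e : f = fun t => Complex.reCLM (g t) := by
    funext t; rw [← h]; simp
  have h1 : HasDerivAt f c.re x := by
    rw [e]
    exact Complex.reCLM.hasFDerivAt.comp_hasDerivAt x hg
  refine ⟨h1, ?_⟩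
  have h2 : HasDerivAt g ((c.re : ℝ) : ℂ) x := by
    have : g = fun t => ((f t : ℝ) : ℂ) := by funext t; rw [h]
    rw [this]
    exact h1.ofReal_comp
  exact h2.unique hg

def cU (x y : ℝ) : ℂ := (x:ℂ) + y * Complex.I
def cV (x y : ℝ) : ℂ := (x:ℂ) - y * Complex.I

lemma cU_x (x y : ℝ) : HasDerivAt (fun t => cU t y) 1 x := by
  unfold cU; exact (Complex.ofRealCLM.hasDerivAt (x := x)).add_const _
lemma cV_x (x y : ℝ) : HasDerivAt (fun t => cV t y) 1 x := by
  unfold cV; exact (Complex.ofRealCLM.hasDerivAt (x := x)).sub_const _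
lemma cU_y (x y : ℝ) : HasDerivAt (fun t => cU x t) Complex.I y := by
  unfold cU
  simpa using ((Complex.ofRealCLM.hasDerivAt (x := y)).mul_const Complex.I).const_add (x:ℂ)
lemma cV_y (x y : ℝ) : HasDerivAt (fun t => cV x t) (-Complex.I) y := by
  unfold cV
  simpa using ((Complex.ofRealCLM.hasDerivAt (x := y)).mul_const Complex.I).const_sub (x:ℂ)

def jX (x y : ℝ) : ℝ := (gGu (cU x y) (cV x y) * 1 + gGv (cU x y) (cV x y) * 1).re
def jY (x y : ℝ) : ℝ :=
  (gGu (cU x y) (cV x y) * Complex.I + gGv (cU x y) (cV x y) * (-Complex.I)).re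

lemma J_x (x y : ℝ) : HasDerivAt (fun t => J9R t y) (jX x y) x ∧
    (jX x y : ℂ) = gGu (cU x y) (cV x y) * 1 + gGv (cU x y) (cV x y) * 1 :=
  real_deriv (fun t => J9R_eq t y) (gG_deriv (cU_x x y) (cV_x x y))

lemma J_y (x y : ℝ) : HasDerivAt (fun t => J9R x t) (jY x y) y ∧
    (jY x y : ℂ) = gGu (cU x y) (cV x y) * Complex.I + gGv (cU x y) (cV x y) * (-Complex.I) :=
  real_deriv (fun t => J9R_eq x t) (gG_deriv (cU_y x y) (cV_y x y))

lemma J_xx (x y : ℝ) : ∃ r : ℝ, HasDerivAt (fun t => jX t y) r x ∧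
    (r : ℂ) = gGuu (cU x y) (cV x y) + 2 * gGuv (cU x y) (cV x y) + gGvv (cU x y) (cV x y) := by
  have h := real_deriv (fun t => (J_x t y).2)
    (((gGu_deriv (cU_x x y) (cV_x x y)).mul_const 1).fun_add
      ((gGv_deriv (cU_x x y) (cV_x x y)).mul_const 1))
  exact ⟨_, h.1, by rw [h.2]; ring⟩

lemma J_yx (x y : ℝ) : ∃ r : ℝ, HasDerivAt (fun t => jX x t) r y ∧
    (r : ℂ) = Complex.I * (gGuu (cU x y) (cV x y) - gGvv (cU x y) (cV x y)) := by
  have h := real_deriv (fun t => (J_x x t).2)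
    (((gGu_deriv (cU_y x y) (cV_y x y)).mul_const 1).fun_add
      ((gGv_deriv (cU_y x y) (cV_y x y)).mul_const 1))
  exact ⟨_, h.1, by rw [h.2]; ring⟩

lemma J_xy (x y : ℝ) : ∃ r : ℝ, HasDerivAt (fun t => jY t y) r x ∧
    (r : ℂ) = Complex.I * (gGuu (cU x y) (cV x y) - gGvv (cU x y) (cV x y)) := by
  have h := real_deriv (fun t => (J_y t y).2)
    (((gGu_deriv (cU_x x y) (cV_x x y)).mul_const Complex.I).fun_add
      ((gGv_deriv (cU_x x y) (cV_x x y)).mul_const (-Complex.I)))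
  exact ⟨_, h.1, by rw [h.2]; ring⟩

lemma J_yy (x y : ℝ) : ∃ r : ℝ, HasDerivAt (fun t => jY x t) r y ∧
    (r : ℂ) =
      -(gGuu (cU x y) (cV x y) - 2 * gGuv (cU x y) (cV x y) + gGvv (cU x y) (cV x y)) := by
  have h := real_deriv (fun t => (J_y x t).2)
    (((gGu_deriv (cU_y x y) (cV_y x y)).mul_const Complex.I).fun_add
      ((gGv_deriv (cU_y x y) (cV_y x y)).mul_const (-Complex.I)))
  refine ⟨_, h.1, ?_⟩
  rw [h.2]
  linear_combination (gGuu (cU x y) (cV x y) - 2 * gGuv (cU x y) (cV x y)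
    + gGvv (cU x y) (cV x y)) * Complex.I_sq

lemma crit_G {x y : ℝ} (hx : jX x y = 0) (hy : jY x y = 0) :
    gGu (cU x y) (cV x y) = 0 ∧ gGv (cU x y) (cV x y) = 0 := by
  have h1 := (J_x x y).2
  have h2 := (J_y x y).2
  rw [hx] at h1
  rw [hy] at h2
  push_cast at h1 h2
  constructor
  · linear_combination -h1/2 + Complex.I/2*h2 + (gGu (cU x y) (cV x y)
      - gGv (cU x y) (cV x y))/2 * Complex.I_sq
  · linear_combination -h1/2 - Complex.I/2*h2 - (gGu (cU x y) (cV x y)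
      - gGv (cU x y) (cV x y))/2 * Complex.I_sq

/-- Hessian determinant of `J9R` is nonzero at critical points. -/
lemma J_nondeg {x y a b b' c : ℝ} (hx : jX x y = 0) (hy : jY x y = 0)
    (ha : HasDerivAt (fun t => jX t y) a x) (hb : HasDerivAt (fun t => jX x t) b y)
    (hb' : HasDerivAt (fun t => jY t y) b' x) (hc : HasDerivAt (fun t => jY x t) c y) :
    a*c - b*b' ≠ 0 := by
  obtain ⟨g1, g2⟩ := crit_G hx hy
  have nd := (crit_fwd g1 g2).2
  obtain ⟨r1, k1, e1⟩ := J_xx x y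
  obtain ⟨r2, k2, e2⟩ := J_yx x y
  obtain ⟨r3, k3, e3⟩ := J_xy x y
  obtain ⟨r4, k4, e4⟩ := J_yy x y
  rw [ha.unique k1, hb.unique k2, hb'.unique k3, hc.unique k4]
  intro h
  have h' : (r1:ℂ)*r4 - r2*r3 = 0 := by exact_mod_cast h
  rw [e1, e2, e3, e4] at h'
  apply nd
  linear_combination h'/4 + (gGuu (cU x y) (cV x y) - gGvv (cU x y) (cV x y))^2/4 * Complex.I_sq

/-! ### Critical points of the real polynomial -/

def ptR (q : ℕ × ℕ) : ℝ × ℝ := ((ptC q).re, (ptC q).im)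

lemma cU_ptR (q : ℕ × ℕ) : cU (ptR q).1 (ptR q).2 = ptC q := by
  unfold cU ptR; exact Complex.re_add_im _

lemma cV_ptR (q : ℕ × ℕ) : cV (ptR q).1 (ptR q).2 = (starRingEnd ℂ) (ptC q) := by
  rw [← cU_ptR]; simp [cU, cV, sub_eq_add_neg]

lemma ptR_crit {i : Fin 3} {q : ℕ × ℕ} (hq : q ∈ TT i) :
    jX (ptR q).1 (ptR q).2 = 0 ∧ jY (ptR q).1 (ptR q).2 = 0 ∧
      J9R (ptR q).1 (ptR q).2 = vv i := by
  obtain ⟨h1, h2, h3⟩ := crit_bwd hq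
  refine ⟨?_, ?_, ?_⟩
  · unfold jX; rw [cU_ptR, cV_ptR, h1, h2]; simp
  · unfold jY; rw [cU_ptR, cV_ptR, h1, h2]; simp
  · have := J9R_eq (ptR q).1 (ptR q).2
    change _ = gG (cU _ _) (cV _ _) at this
    rw [cU_ptR, cV_ptR, h3] at this
    exact_mod_cast this

lemma ptR_surj {x y : ℝ} (hx : jX x y = 0) (hy : jY x y = 0) :
    ∃ i, ∃ q ∈ TT i, ptR q = (x, y) ∧ J9R x y = vv i := by
  obtain ⟨g1, g2⟩ := crit_G hx hy
  obtain ⟨i, q, hq, e⟩ := (crit_fwd g1 g2).1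
  have e' : ptR q = (x, y) := by
    unfold ptR; rw [e]; simp [cU]
  refine ⟨i, q, hq, e', ?_⟩
  have := (ptR_crit hq).2.2
  rwa [e'] at this

lemma ptR_inj {i j : Fin 3} {q q' : ℕ × ℕ} (hq : q ∈ TT i) (hq' : q' ∈ TT j)
    (h : ptR q = ptR q') : q = q' := by
  apply ptC_inj hq hq'
  rw [← cU_ptR, ← cU_ptR, h]

lemma vv_inj {i j : Fin 3} (h : vv i = vv j) : i = j := by
  fin_cases i <;> fin_cases j <;> first | rfl | (exfalso; norm_num [vv] at h)

/-- The index set of all singular points. -/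
def allIdx : Finset (Σ _ : Fin 3, (ℕ × ℕ) × (ℕ × ℕ)) :=
  Finset.univ.sigma fun i => TT i ×ˢ TT i

lemma card_allIdx : allIdx.card = 1738 := by
  unfold allIdx
  rw [Finset.card_sigma, Fin.sum_univ_three]
  simp only [Finset.card_product, card_TT0, card_TT1, card_TT2]

def pt4 (s : Σ _ : Fin 3, (ℕ × ℕ) × (ℕ × ℕ)) : Fin 4 → ℝ :=
  ![(ptR s.2.1).1, (ptR s.2.1).2, (ptR s.2.2).1, (ptR s.2.2).2]

lemma pt4_inj : Set.InjOn pt4 (allIdx : Set (Σ _ : Fin 3, (ℕ × ℕ) × (ℕ × ℕ))) := by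
  rintro ⟨i, q, r⟩ h ⟨j, q', r'⟩ h' e
  simp only [allIdx, Finset.coe_sigma, Set.mem_sigma_iff, Finset.mem_coe, Finset.mem_univ,
    true_and, Finset.mem_product] at h h'
  have e0 : (ptR q).1 = (ptR q').1 := congrFun e 0
  have e1 : (ptR q).2 = (ptR q').2 := congrFun e 1
  have e2 : (ptR r).1 = (ptR r').1 := congrFun e 2
  have e3 : (ptR r).2 = (ptR r').2 := congrFun e 3
  have a1 : q = q' := ptR_inj h.1 h'.1 (Prod.ext e0 e1)
  have a2 : r = r' := ptR_inj h.2 h'.2 (Prod.ext e2 e3)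
  have a3 : i = j := by
    apply vv_inj
    rw [← (ptR_crit h.1).2.2, ← (ptR_crit h'.1).2.2, a1]
  subst a1 a2 a3
  rfl

lemma pd_eqs (f : (Fin 4 → ℝ) → ℝ)
    (hf : ∀ p, f p = J9R (p 0) (p 1) - J9R (p 2) (p 3)) :
    pd 0 f = (fun p => jX (p 0) (p 1)) ∧ pd 1 f = (fun p => jY (p 0) (p 1)) ∧
    pd 2 f = (fun p => - jX (p 2) (p 3)) ∧ pd 3 f = (fun p => - jY (p 2) (p 3)) := by
  obtain rfl : f = fun p => J9R (p 0) (p 1) - J9R (p 2) (p 3) := funext hf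
  refine ⟨?_, ?_, ?_, ?_⟩ <;> funext p <;> unfold pd <;>
    simp only [Function.update_apply, Fin.isValue, Fin.reduceEq, if_true, if_false]
  · exact ((J_x (p 0) (p 1)).1.sub_const _).deriv
  · exact ((J_y (p 0) (p 1)).1.sub_const _).deriv
  · exact ((J_x (p 2) (p 3)).1.const_sub _).deriv
  · exact ((J_y (p 2) (p 3)).1.const_sub _).deriv

lemma hess_det (f : (Fin 4 → ℝ) → ℝ)
    (hf : ∀ p, f p = J9R (p 0) (p 1) - J9R (p 2) (p 3)) (p : Fin 4 → ℝ)
    (h0 : jX (p 0) (p 1) = 0) (h1 : jY (p 0) (p 1) = 0)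
    (h2 : jX (p 2) (p 3) = 0) (h3 : jY (p 2) (p 3) = 0) : (hessian f p).det ≠ 0 := by
  obtain ⟨e0, e1, e2, e3⟩ := pd_eqs f hf
  obtain ⟨a, ha, -⟩ := J_xx (p 0) (p 1)
  obtain ⟨b, hb, -⟩ := J_yx (p 0) (p 1)
  obtain ⟨b', hb', -⟩ := J_xy (p 0) (p 1)
  obtain ⟨c, hc, -⟩ := J_yy (p 0) (p 1)
  obtain ⟨A, hA, -⟩ := J_xx (p 2) (p 3)
  obtain ⟨B, hB, -⟩ := J_yx (p 2) (p 3)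
  obtain ⟨B', hB', -⟩ := J_xy (p 2) (p 3)
  obtain ⟨C, hC, -⟩ := J_yy (p 2) (p 3)
  have n1 := J_nondeg h0 h1 ha hb hb' hc
  have n2 := J_nondeg h2 h3 hA hB hB' hC
  have hH : hessian f p = !![a, b', 0, 0; b, c, 0, 0; 0, 0, -A, -B'; 0, 0, -B, -C] := by
    ext i j
    fin_cases i <;> fin_cases j <;>
      simp only [hessian, Matrix.of_apply, Fin.zero_eta, Fin.mk_one, Fin.reduceFinMk, e0, e1, e2,
        e3] <;> unfold pd <;>
      simp only [Function.update_apply, Fin.isValue, Fin.reduceEq, if_true, if_false] <;>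
      simp [ha.deriv, hb.deriv, hb'.deriv, hc.deriv, hA.deriv, hB.deriv, hB'.deriv, hC.deriv]
  have hd : (hessian f p).det = (a*c - b*b')*(A*C - B*B') := by
    rw [hH]
    simp [Matrix.det_succ_row_zero, Fin.sum_univ_succ, Fin.succAbove]
    ring
  rw [hd]
  exact mul_ne_zero n1 n2

/-- The affine three-fold `J9(x₀,x₁) - J9(x₂,x₃) = 0` in `ℝ⁴` has exactly 1738 real
singular points, all of them nodes (the Hessian is invertible there). -/
theorem stmt (f : (Fin 4 → ℝ) → ℝ)
    (hf : ∀ p, f p = J9R (p 0) (p 1) - J9R (p 2) (p 3)) :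
    {p : Fin 4 → ℝ | f p = 0 ∧ ∀ i, pd i f p = 0}.Finite ∧
    {p : Fin 4 → ℝ | f p = 0 ∧ ∀ i, pd i f p = 0}.ncard = 1738 ∧
    ∀ p : Fin 4 → ℝ, f p = 0 → (∀ i, pd i f p = 0) → (hessian f p).det ≠ 0 := by

  obtain ⟨e0, e1, e2, e3⟩ := pd_eqs f hf
  have crit : ∀ p : Fin 4 → ℝ, (∀ i, pd i f p = 0) ↔
      jX (p 0) (p 1) = 0 ∧ jY (p 0) (p 1) = 0 ∧ jX (p 2) (p 3) = 0 ∧ jY (p 2) (p 3) = 0 := by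
    intro p
    rw [Fin.forall_fin_succ, Fin.forall_fin_succ, Fin.forall_fin_succ, Fin.forall_fin_succ]
    change pd 0 f p = 0 ∧ pd 1 f p = 0 ∧ pd 2 f p = 0 ∧ pd 3 f p = 0 ∧ _ ↔ _
    rw [e0, e1, e2, e3]
    simp
  have hset : {p : Fin 4 → ℝ | f p = 0 ∧ ∀ i, pd i f p = 0}
      = pt4 '' (allIdx : Set (Σ _ : Fin 3, (ℕ × ℕ) × (ℕ × ℕ))) := by
    ext p
    rw [Set.mem_setOf_eq, crit, hf]
    constructor
    · rintro ⟨h, h0, h1, h2, h3⟩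
      obtain ⟨i, q, hq, eq, vq⟩ := ptR_surj h0 h1
      obtain ⟨j, r, hr, er, vr⟩ := ptR_surj h2 h3
      have hij : i = j := vv_inj (by rw [← vq, ← vr]; linarith)
      subst hij
      refine ⟨⟨i, q, r⟩, ?_, ?_⟩
      · simp only [allIdx, Finset.coe_sigma, Set.mem_sigma_iff, Finset.mem_coe, Finset.mem_univ,
          true_and, Finset.mem_product]
        exact ⟨hq, hr⟩
      · funext n
        fin_cases n <;> simp [pt4, eq, er]
    · rintro ⟨⟨i, q, r⟩, h, rfl⟩
      simp only [allIdx, Finset.coe_sigma, Set.mem_sigma_iff, Finset.mem_coe, Finset.mem_univ,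
        true_and, Finset.mem_product] at h
      obtain ⟨a1, a2, a3⟩ := ptR_crit h.1
      obtain ⟨b1, b2, b3⟩ := ptR_crit h.2
      change J9R (ptR q).1 (ptR q).2 - J9R (ptR r).1 (ptR r).2 = 0 ∧ _
      exact ⟨by rw [a3, b3, sub_self], a1, a2, b1, b2⟩
  refine ⟨?_, ?_, ?_⟩
  · rw [hset]
    exact (Finset.finite_toSet _).image _
  · rw [hset, Set.ncard_image_of_injOn pt4_inj, Set.ncard_coe_finset, card_allIdx]
  · intro p _ hp
    obtain ⟨h0, h1, h2, h3⟩ := (crit p).1 hp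
    exact hess_det f hf p h0 h1 h2 h3
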